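/- Every right-G-monogenic mapping Φ : Ω_ζ → ℍ(ℂ) decomposes as Φ = Φ₁₀ + Φ₂₀, where Φ₁₀ := e₂Φ takes values in 𝓘₁ and Φ₂₀ := e₁Φ takes values in 𝓘₂, and both Φ₁₀ and Φ₂₀ are right-G-monogenic in Ω_ζ. Likewise, every left-G-monogenic mapping Φ̂ : Ω_ζ → ℍ(ℂ) decomposes as Φ̂ = Φ̂₁₀ + Φ̂₂₀, where Φ̂₁₀ takes values in 𝓘̂₁, Φ̂₂₀ takes values in 𝓘̂₂, and both are left-G-monogenic in Ω_ζ. -/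

import Mathlib

open Filter Set Topology Quaternion

noncomputable section

abbrev HC : Type := ℍ[ℂ, -1, -1]

/-- The idempotent `e₁ = (1 + iI)/2`. -/
def e1 : HC := ⟨1/2, Complex.I/2, 0, 0⟩
/-- The idempotent `e₂ = (1 - iI)/2`. -/
def e2 : HC := ⟨1/2, -(Complex.I/2), 0, 0⟩
/-- `e₃ = (iJ - K)/2`. -/
def e3 : HC := ⟨0, 0, Complex.I/2, -(1/2)⟩
/-- `e₄ = (iJ + K)/2`. -/
def e4 : HC := ⟨0, 0, Complex.I/2, 1/2⟩

/-- Topology on `ℍ(ℂ)` induced from the four complex coordinates. -/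
instance : TopologicalSpace HC :=
  TopologicalSpace.induced (fun q : HC => (q.re, q.imI, q.imJ, q.imK)) inferInstance

/-- Coordinate of `a ∈ ℍ(ℂ)` at `e₁` in the basis `{e₁, e₂, e₃, e₄}`. -/
def c1 (a : HC) : ℂ := a.re - Complex.I * a.imI
/-- Coordinate at `e₂`. -/
def c2 (a : HC) : ℂ := a.re + Complex.I * a.imI
/-- Coordinate at `e₃`. -/
def c3 (a : HC) : ℂ := -(Complex.I * a.imJ) - a.imK
/-- Coordinate at `e₄`. -/
def c4 (a : HC) : ℂ := -(Complex.I * a.imJ) + a.imK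

/-- The norm `‖a‖ = √(|a₁|² + |a₂|² + |a₃|² + |a₄|²)`, coordinates in the basis `{e₁,e₂,e₃,e₄}`. -/
def qnorm (a : HC) : ℝ :=
  Real.sqrt (‖c1 a‖ ^ 2 + ‖c2 a‖ ^ 2 +
    ‖c3 a‖ ^ 2 + ‖c4 a‖ ^ 2)

/-- `f₁ : ℍ(ℂ) → ℂ`, the ℂ-linear functional with `f₁(e₁) = f₁(e₃) = 1`, `f₁(e₂) = f₁(e₄) = 0`. -/
def f1 (a : HC) : ℂ := c1 a + c3 a
/-- `f₂ : ℍ(ℂ) → ℂ`, with `f₂(e₂) = f₂(e₄) = 1`, `f₂(e₁) = f₂(e₃) = 0`. -/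
def f2 (a : HC) : ℂ := c2 a + c4 a
/-- `f̂₁ : ℍ(ℂ) → ℂ`, with `f̂₁(e₁) = f̂₁(e₄) = 1`, `f̂₁(e₂) = f̂₁(e₃) = 0`. -/
def fh1 (a : HC) : ℂ := c1 a + c4 a
/-- `f̂₂ : ℍ(ℂ) → ℂ`, with `f̂₂(e₂) = f̂₂(e₃) = 1`, `f̂₂(e₁) = f̂₂(e₄) = 0`. -/
def fh2 (a : HC) : ℂ := c2 a + c3 a

/-- `ζ = x i₁ + y i₂ + z i₃` for `p = (x, y, z) ∈ ℝ³` (with `i₁ = 1`). -/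
def zeta (i2 i3 : HC) (p : ℝ × ℝ × ℝ) : HC :=
  (p.1 : ℂ) • (1 : HC) + (p.2.1 : ℂ) • i2 + (p.2.2 : ℂ) • i3

/-- The real linear span `E₃` of `i₁ = 1, i₂, i₃`. -/
def E3 (i2 i3 : HC) : Set HC := Set.range (zeta i2 i3)

/-- `i₁ = 1, i₂, i₃` are linearly independent over `ℝ`. -/
def LinIndep (i2 i3 : HC) : Prop :=
  ∀ α₁ α₂ α₃ : ℝ, (α₁ : ℂ) • (1 : HC) + (α₂ : ℂ) • i2 + (α₃ : ℂ) • i3 = 0 →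
    α₁ = 0 ∧ α₂ = 0 ∧ α₃ = 0

/-- `Φ` is right-G-monogenic on `S` (w.r.t. directions in `E₃`): it is continuous on `S` and at
every `ζ ∈ S` there is `Φ'(ζ)` with `lim_{ε→0+} (Φ(ζ+εh) − Φ(ζ))ε⁻¹ = h·Φ'(ζ)` for all `h ∈ E₃`. -/
def RightGMonogenic (i2 i3 : HC) (Φ : HC → HC) (S : Set HC) : Prop :=
  ContinuousOn Φ S ∧ ∀ ζ ∈ S, ∃ Φ' : HC, ∀ h ∈ E3 i2 i3,
    Tendsto (fun ε : ℝ => ((ε : ℂ))⁻¹ • (Φ (ζ + (ε : ℂ) • h) - Φ ζ))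
      (nhdsWithin 0 (Set.Ioi 0)) (nhds (h * Φ'))

/-- `Φ̂` is left-G-monogenic on `S`. -/
def LeftGMonogenic (i2 i3 : HC) (Φ : HC → HC) (S : Set HC) : Prop :=
  ContinuousOn Φ S ∧ ∀ ζ ∈ S, ∃ Φ' : HC, ∀ h ∈ E3 i2 i3,
    Tendsto (fun ε : ℝ => ((ε : ℂ))⁻¹ • (Φ (ζ + (ε : ℂ) • h) - Φ ζ))
      (nhdsWithin 0 (Set.Ioi 0)) (nhds (Φ' * h))

/-- The right maximal ideal `𝓘₁ = {λ₂e₂ + λ₄e₄}`. -/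
def I1 : Set HC := {a | ∃ l2 l4 : ℂ, a = l2 • e2 + l4 • e4}
/-- The right maximal ideal `𝓘₂ = {λ₁e₁ + λ₃e₃}`. -/
def I2 : Set HC := {a | ∃ l1 l3 : ℂ, a = l1 • e1 + l3 • e3}
/-- The left maximal ideal `𝓘̂₁ = {λ₂e₂ + λ₃e₃}`. -/
def Ih1 : Set HC := {a | ∃ l2 l3 : ℂ, a = l2 • e2 + l3 • e3}
/-- The left maximal ideal `𝓘̂₂ = {λ₁e₁ + λ₄e₄}`. -/
def Ih2 : Set HC := {a | ∃ l1 l4 : ℂ, a = l1 • e1 + l4 • e4}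

/-- The line `L` in `ℝ³` given by `x + y·Re a + z·Re b = 0`, `y·Im a + z·Im b = 0`. -/
def lineL (a b : ℂ) : Set (ℝ × ℝ × ℝ) :=
  {p | p.1 + p.2.1 * a.re + p.2.2 * b.re = 0 ∧ p.2.1 * a.im + p.2.2 * b.im = 0}

/-- `Ω` is convex in the direction of the line `L` (a line through the origin): it contains every
segment parallel to `L` joining two of its points. -/
def ConvexInDirection (Ω : Set (ℝ × ℝ × ℝ)) (L : Set (ℝ × ℝ × ℝ)) : Prop :=
  ∀ p ∈ Ω, ∀ q ∈ Ω, q - p ∈ L → segment ℝ p q ⊆ Ω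

/-- `ξ = x + y·a + z·b` for `p = (x,y,z)`. -/
def xi (a b : ℂ) (p : ℝ × ℝ × ℝ) : ℂ := (p.1 : ℂ) + (p.2.1 : ℂ) * a + (p.2.2 : ℂ) * b


/-- `Φ'` is a right Gateaux derivative of `Φ` on `S` (directions in `E₃`). -/
def IsRightGDeriv (i2 i3 : HC) (Φ Φ' : HC → HC) (S : Set HC) : Prop :=
  ∀ ζ ∈ S, ∀ h ∈ E3 i2 i3,
    Tendsto (fun ε : ℝ => ((ε : ℂ))⁻¹ • (Φ (ζ + (ε : ℂ) • h) - Φ ζ))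
      (nhdsWithin 0 (Set.Ioi 0)) (nhds (h * Φ' ζ))

/-- `Φ'` is a left Gateaux derivative of `Φ` on `S`. -/
def IsLeftGDeriv (i2 i3 : HC) (Φ Φ' : HC → HC) (S : Set HC) : Prop :=
  ∀ ζ ∈ S, ∀ h ∈ E3 i2 i3,
    Tendsto (fun ε : ℝ => ((ε : ℂ))⁻¹ • (Φ (ζ + (ε : ℂ) • h) - Φ ζ))
      (nhdsWithin 0 (Set.Ioi 0)) (nhds (Φ' ζ * h))

/-- Triples `(α, β, γ)` of naturals with `α + β + γ = n`. -/
def trip (n : ℕ) : Finset (ℕ × ℕ × ℕ) :=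
  (Finset.range (n + 1) ×ˢ Finset.range (n + 1) ×ˢ Finset.range (n + 1)).filter
    (fun u => u.1 + u.2.1 + u.2.2 = n)

theorem hc_cont_iff {X : Type*} [TopologicalSpace X] (f : X → HC) :
    Continuous f ↔ Continuous (fun x => ((f x).re, (f x).imI, (f x).imJ, (f x).imK)) :=
  continuous_induced_rng

theorem hc_coords : Continuous (fun q : HC => (q.re, q.imI, q.imJ, q.imK)) :=
  continuous_induced_dom

theorem hc_re : Continuous (fun q : HC => q.re) := hc_coords.fst
theorem hc_imI : Continuous (fun q : HC => q.imI) := hc_coords.snd.fst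
theorem hc_imJ : Continuous (fun q : HC => q.imJ) := hc_coords.snd.snd.fst
theorem hc_imK : Continuous (fun q : HC => q.imK) := hc_coords.snd.snd.snd

theorem hc_mul_left (c : HC) : Continuous (fun q : HC => c * q) := by
  have h0 := hc_re
  have h1 := hc_imI
  have h2 := hc_imJ
  have h3 := hc_imK
  rw [hc_cont_iff]
  simp only [QuaternionAlgebra.re_mul, QuaternionAlgebra.imI_mul, QuaternionAlgebra.imJ_mul,
    QuaternionAlgebra.imK_mul]
  fun_prop

theorem hc_mul_right (c : HC) : Continuous (fun q : HC => q * c) := by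
  have h0 := hc_re
  have h1 := hc_imI
  have h2 := hc_imJ
  have h3 := hc_imK
  rw [hc_cont_iff]
  simp only [QuaternionAlgebra.re_mul, QuaternionAlgebra.imI_mul, QuaternionAlgebra.imJ_mul,
    QuaternionAlgebra.imK_mul]
  fun_prop

theorem e1_add_e2 : e2 + e1 = (1 : HC) := by
  ext <;> simp [e1, e2] <;> norm_num

theorem e1_comm_e2 : e1 * e2 = e2 * e1 := by
  ext <;> simp [e1, e2] <;> ring

theorem E3_comm {a₁ a₂ b₁ b₂ : ℂ} {i2 i3 : HC}
    (hi2 : i2 = a₁ • e1 + a₂ • e2) (hi3 : i3 = b₁ • e1 + b₂ • e2) {h : HC}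
    (hh : h ∈ E3 i2 i3) : e1 * h = h * e1 ∧ e2 * h = h * e2 := by
  obtain ⟨p, rfl⟩ := hh
  subst hi2 hi3
  constructor <;>
    simp only [zeta, mul_add, add_mul, mul_smul_comm, smul_mul_assoc, mul_one, one_mul,
      e1_comm_e2]

theorem right_mul {i2 i3 : HC} {Φ : HC → HC} {S : Set HC} (hΦ : RightGMonogenic i2 i3 Φ S)
    (e : HC) (he : ∀ h ∈ E3 i2 i3, e * h = h * e) :
    RightGMonogenic i2 i3 (fun ζ => e * Φ ζ) S := by
  refine ⟨(hc_mul_left e).comp_continuousOn hΦ.1, fun ζ hζ => ?_⟩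
  obtain ⟨Φ', H⟩ := hΦ.2 ζ hζ
  refine ⟨e * Φ', fun h hh => ?_⟩
  have := ((hc_mul_left e).tendsto _).comp (H h hh)
  rw [← mul_assoc, ← he h hh, mul_assoc]
  refine this.congr fun ε => ?_
  simp only [Function.comp, mul_smul_comm, mul_sub]

theorem left_mul {i2 i3 : HC} {Φ : HC → HC} {S : Set HC} (hΦ : LeftGMonogenic i2 i3 Φ S)
    (e : HC) (he : ∀ h ∈ E3 i2 i3, e * h = h * e) :
    LeftGMonogenic i2 i3 (fun ζ => Φ ζ * e) S := by
  refine ⟨(hc_mul_right e).comp_continuousOn hΦ.1, fun ζ hζ => ?_⟩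
  obtain ⟨Φ', H⟩ := hΦ.2 ζ hζ
  refine ⟨Φ' * e, fun h hh => ?_⟩
  have := ((hc_mul_right e).tendsto _).comp (H h hh)
  rw [mul_assoc, he h hh, ← mul_assoc]
  refine this.congr fun ε => ?_
  simp only [Function.comp, smul_mul_assoc, sub_mul]

theorem mem_I1 (q : HC) : e2 * q ∈ I1 := by
  refine ⟨c2 q, c4 q, ?_⟩
  ext <;> simp [e2, e4, c2, c4] <;> ring_nf <;> simp <;> ring

theorem mem_I2 (q : HC) : e1 * q ∈ I2 := by
  refine ⟨c1 q, c3 q, ?_⟩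
  ext <;> simp [e1, e3, c1, c3] <;> ring_nf <;> simp <;> ring

theorem mem_Ih1 (q : HC) : q * e2 ∈ Ih1 := by
  refine ⟨c2 q, c3 q, ?_⟩
  ext <;> simp [e2, e3, c2, c3] <;> ring_nf <;> simp <;> ring

theorem mem_Ih2 (q : HC) : q * e1 ∈ Ih2 := by
  refine ⟨c1 q, c4 q, ?_⟩
  ext <;> simp [e1, e4, c1, c4] <;> ring_nf <;> simp <;> ring

/-- Theorem 2: every right-G-monogenic map decomposes as `Φ = e₂Φ + e₁Φ` with
`e₂Φ` valued in `𝓘₁`, `e₁Φ` valued in `𝓘₂`, both right-G-monogenic; every left-G-monogenic map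
decomposes as a sum of left-G-monogenic maps valued in `𝓘̂₁` and `𝓘̂₂`. -/
theorem statement9 (a₁ a₂ b₁ b₂ : ℂ) (i2 i3 : HC)
    (hi2 : i2 = a₁ • e1 + a₂ • e2) (hi3 : i3 = b₁ • e1 + b₂ • e2)
    (hLI : LinIndep i2 i3)
    (Ω : Set (ℝ × ℝ × ℝ)) (hΩo : IsOpen Ω) (hΩc : IsConnected Ω) :
    (∀ Φ : HC → HC, RightGMonogenic i2 i3 Φ (zeta i2 i3 '' Ω) →
      (∀ ζ : HC, Φ ζ = e2 * Φ ζ + e1 * Φ ζ) ∧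
      (∀ ζ : HC, e2 * Φ ζ ∈ I1) ∧ (∀ ζ : HC, e1 * Φ ζ ∈ I2) ∧
      RightGMonogenic i2 i3 (fun ζ => e2 * Φ ζ) (zeta i2 i3 '' Ω) ∧
      RightGMonogenic i2 i3 (fun ζ => e1 * Φ ζ) (zeta i2 i3 '' Ω)) ∧
    (∀ Φh : HC → HC, LeftGMonogenic i2 i3 Φh (zeta i2 i3 '' Ω) →
      ∃ Φh10 Φh20 : HC → HC,
        (∀ ζ ∈ zeta i2 i3 '' Ω, Φh ζ = Φh10 ζ + Φh20 ζ) ∧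
        (∀ ζ ∈ zeta i2 i3 '' Ω, Φh10 ζ ∈ Ih1) ∧ (∀ ζ ∈ zeta i2 i3 '' Ω, Φh20 ζ ∈ Ih2) ∧
        LeftGMonogenic i2 i3 Φh10 (zeta i2 i3 '' Ω) ∧
        LeftGMonogenic i2 i3 Φh20 (zeta i2 i3 '' Ω)) := by
  have k1 : ∀ h ∈ E3 i2 i3, e1 * h = h * e1 := fun h hh => (E3_comm hi2 hi3 hh).1
  have k2 : ∀ h ∈ E3 i2 i3, e2 * h = h * e2 := fun h hh => (E3_comm hi2 hi3 hh).2
  refine ⟨fun Φ hΦ => ⟨fun ζ => ?_, fun ζ => mem_I1 _, fun ζ => mem_I2 _,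
    right_mul hΦ e2 k2, right_mul hΦ e1 k1⟩, fun Φ hΦ => ⟨fun ζ => Φ ζ * e2, fun ζ => Φ ζ * e1,
    fun ζ _ => ?_, fun ζ _ => mem_Ih1 _, fun ζ _ => mem_Ih2 _,
    left_mul hΦ e2 k2, left_mul hΦ e1 k1⟩⟩
  · rw [← add_mul, e1_add_e2, one_mul]
  · rw [← mul_add, e1_add_e2, mul_one]

end
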